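/- arXiv:0904.1325 — 2 statements merged into one kernel-verified Lean document; each statement's English description precedes it below -/
import Mathlib

section
/- For every integer n ≥ 0, the dimension of S_n (equivalently, of the degree-n component of the algebra of covariants of the binary d-form) equals the number of tuples α = (α_0, …, α_d) ∈ ℕ^{d+1} with α_0 + α_1 + ⋯ + α_d = n and 2(α_1 + 2α_2 + ⋯ + dα_d) = dn, plus the number of tuples α ∈ ℕ^{d+1} with α_0 + α_1 + ⋯ + α_d = n and 2(α_1 + 2α_2 + ⋯ + dα_d) = dn − 1. (Sylvester–Cayley-type formula, Theorem 1.) -/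
noncomputable section

/-- The derivation D₁ on ℂ[x_0,…,x_d] with D₁(x_0)=0 and D₁(x_i)=i·x_{i-1}
(for i = 0 the coefficient i vanishes, so the wrap-around in `Fin` is harmless). -/
def D1 (d : ℕ) :
    Derivation ℂ (MvPolynomial (Fin (d + 1)) ℂ) (MvPolynomial (Fin (d + 1)) ℂ) :=
  MvPolynomial.mkDerivation ℂ (fun i => (i.val : ℂ) • MvPolynomial.X (i - 1))

/-- S_n: the space of homogeneous degree-n seminvariants of the binary d-form. -/
def Sn (d n : ℕ) : Submodule ℂ (MvPolynomial (Fin (d + 1)) ℂ) :=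
  MvPolynomial.homogeneousSubmodule (Fin (d + 1)) ℂ n ⊓ LinearMap.ker (D1 d).toLinearMap

namespace MvPolynomial

variable {σ R M : Type*} [CommRing R]

theorem IsWeightedHomogeneous.derivation [AddCommGroup M] {w : σ → M} {s : M}
    {D : Derivation R (MvPolynomial σ R) (MvPolynomial σ R)}
    (hD : ∀ i, IsWeightedHomogeneous w (D (X i)) (w i + s))
    {p : MvPolynomial σ R} {m : M} (hp : IsWeightedHomogeneous w p m) :
    IsWeightedHomogeneous w (D p) (m + s) := by
  induction hp using IsWeightedHomogeneous.induction_on with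
  | zero => simpa using isWeightedHomogeneous_zero R w (m + s)
  | add p q _ _ hp hq => simpa using hp.add hq
  | monomial a r ha =>
    have hD' : D = mkDerivation R (fun i => D (X i)) := derivation_ext fun i => by simp
    rw [hD', mkDerivation_monomial]
    refine Submodule.smul_mem (weightedHomogeneousSubmodule R w (m + s)) r ?_
    refine Submodule.sum_mem _ fun i hi => ?_
    have hi' : a i ≠ 0 := Finsupp.mem_support_iff.mp hi
    have h := (isWeightedHomogeneous_monomial w (a - Finsupp.single i 1) (a i : R) rfl).mul (hD i)
    rwa [← add_assoc, Finsupp.weight_sub_single_add hi', ha] at h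

theorem weightedHomogeneousComponent_derivation [AddCommGroup M] {w : σ → M} {s : M}
    {D : Derivation R (MvPolynomial σ R) (MvPolynomial σ R)}
    (hD : ∀ i, IsWeightedHomogeneous w (D (X i)) (w i + s)) (p : MvPolynomial σ R) (m : M) :
    D (weightedHomogeneousComponent w m p) = weightedHomogeneousComponent w (m + s) (D p) := by
  classical
  induction p using MvPolynomial.induction_on' with
  | add p q hp hq => simp [hp, hq]
  | monomial a r =>
    have ha := isWeightedHomogeneous_monomial w a r rfl
    rw [weightedHomogeneousComponent_of_mem ha,
      weightedHomogeneousComponent_of_mem (ha.derivation hD)]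
    by_cases h : m = Finsupp.weight w a <;> simp [h, add_left_inj]

theorem mkDerivation_smul_X_monomial (c : σ → R) (a : σ →₀ ℕ) (r : R) :
    mkDerivation R (fun i => c i • X i) (monomial a r) =
      (a.sum fun i k => (k : R) * c i) • monomial a r := by
  rw [mkDerivation_monomial]
  unfold Finsupp.sum
  rw [Finset.sum_smul, Finset.smul_sum]
  refine Finset.sum_congr rfl fun i hi => ?_
  have hi' : a i ≠ 0 := Finsupp.mem_support_iff.mp hi
  beta_reduce
  rw [smul_eq_mul, mul_smul_comm, X, monomial_mul, Finsupp.sub_add_single_one_cancel hi',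
    smul_monomial, smul_monomial, smul_monomial]
  refine congrArg (monomial a) ?_
  simp only [smul_eq_mul, mul_one]
  ring

end MvPolynomial

open MvPolynomial

/-- The bidegree of the variables: the degree together with the index. -/
def biweight (d : ℕ) (i : Fin (d + 1)) : ℤ × ℤ := (1, (i.val : ℤ))

/-- The raising derivation `x_i ↦ (d - i) x_{i+1}`. -/
def D2 (d : ℕ) :
    Derivation ℂ (MvPolynomial (Fin (d + 1)) ℂ) (MvPolynomial (Fin (d + 1)) ℂ) :=
  mkDerivation ℂ (fun i => ((d : ℂ) - i.val) • X (i + 1))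

theorem weight_biweight (d : ℕ) (a : Fin (d + 1) →₀ ℕ) :
    Finsupp.weight (biweight d) a =
      (((∑ i, a i : ℕ) : ℤ), ((∑ i, i.val * a i : ℕ) : ℤ)) := by
  rw [Finsupp.weight_apply, Finsupp.sum_fintype _ _ (by simp)]
  ext <;> simp [biweight, Prod.fst_sum, Prod.snd_sum, mul_comm]

theorem isWeightedHomogeneous_D1_X (d : ℕ) (i : Fin (d + 1)) :
    IsWeightedHomogeneous (biweight d) (D1 d (X i)) (biweight d i + (0, -1)) := by
  rw [D1, mkDerivation_X]
  by_cases hi : i = 0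
  · simpa [hi] using isWeightedHomogeneous_zero ℂ (biweight d) _
  · have h : biweight d i + (0, -1) = biweight d (i - 1) := by
      have : i.val ≠ 0 := fun h => hi (Fin.ext h)
      ext <;> simp [biweight, Fin.val_sub_one_of_ne_zero hi]
      omega
    rw [h]
    exact Submodule.smul_mem (weightedHomogeneousSubmodule ℂ (biweight d) _) _
      (isWeightedHomogeneous_X ℂ _ _)

theorem isWeightedHomogeneous_D2_X (d : ℕ) (i : Fin (d + 1)) :
    IsWeightedHomogeneous (biweight d) (D2 d (X i)) (biweight d i + (0, 1)) := by
  rw [D2, mkDerivation_X]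
  by_cases hi : i = Fin.last d
  · simpa [hi] using isWeightedHomogeneous_zero ℂ (biweight d) _
  · have h : biweight d i + (0, 1) = biweight d (i + 1) := by
      ext <;> simp [biweight, Fin.val_add_one, hi]
    rw [h]
    exact Submodule.smul_mem (weightedHomogeneousSubmodule ℂ (biweight d) _) _
      (isWeightedHomogeneous_X ℂ _ _)

theorem lie_D1_D2 (d : ℕ) :
    ⁅D1 d, D2 d⁆ = mkDerivation ℂ (fun i : Fin (d + 1) => ((d : ℂ) - 2 * i.val) • X i) := by
  refine derivation_ext fun i => ?_
  rw [Derivation.commutator_apply]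
  have h₁ : D1 d (D2 d (X i)) = (((d : ℂ) - i.val) * (i.val + 1)) • X i := by
    simp only [D1, D2, mkDerivation_X, Derivation.map_smul]
    by_cases hi : i = Fin.last d
    · simp [hi]
    · simp [Fin.val_add_one, hi, smul_smul]
  have h₂ : D2 d (D1 d (X i)) = ((i.val : ℂ) * (d - i.val + 1)) • X i := by
    simp only [D1, D2, mkDerivation_X, Derivation.map_smul]
    by_cases hi : i = 0
    · simp [hi]
    · have h : 1 ≤ i.val := Nat.one_le_iff_ne_zero.mpr fun h => hi (Fin.ext h)
      rw [smul_smul, sub_add_cancel, Fin.val_sub_one_of_ne_zero hi, Nat.cast_sub h]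
      congr 1
      push_cast
      ring
  rw [h₁, h₂, mkDerivation_X, ← sub_smul]
  congr 1
  ring

theorem D1_D2_apply {d : ℕ} {n w : ℤ} {v : MvPolynomial (Fin (d + 1)) ℂ}
    (hv : IsWeightedHomogeneous (biweight d) v (n, w)) :
    D1 d (D2 d v) = D2 d (D1 d v) + ((d * n - 2 * w : ℤ) : ℂ) • v := by
  rw [← sub_eq_iff_eq_add', ← Derivation.commutator_apply, lie_D1_D2]
  induction hv using IsWeightedHomogeneous.induction_on with
  | zero => simp
  | add p q _ _ hp hq => simp [hp, hq]
  | monomial a r ha =>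
    rw [mkDerivation_smul_X_monomial]
    congr 1
    rw [weight_biweight, Prod.mk.injEq] at ha
    rw [← ha.1, ← ha.2, Finsupp.sum_fintype _ _ (by simp)]
    push_cast
    rw [Finset.mul_sum, Finset.mul_sum, ← Finset.sum_sub_distrib]
    exact Finset.sum_congr rfl fun i _ => by ring

theorem eq_zero_of_neg {d : ℕ} {n w : ℤ} {v : MvPolynomial (Fin (d + 1)) ℂ}
    (hv : IsWeightedHomogeneous (biweight d) v (n, w)) (hw : w < 0) : v = 0 := by
  refine hv.eq_zero_of_no_monomials fun a ha => ?_
  rw [weight_biweight, Prod.mk.injEq] at ha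
  omega

theorem eq_zero_of_gt {d : ℕ} {n w : ℤ} {v : MvPolynomial (Fin (d + 1)) ℂ}
    (hv : IsWeightedHomogeneous (biweight d) v (n, w)) (hw : d * n < w) : v = 0 := by
  refine hv.eq_zero_of_no_monomials fun a ha => ?_
  rw [weight_biweight, Prod.mk.injEq] at ha
  have h : ∑ i, i.val * a i ≤ d * ∑ i, a i := by
    rw [Finset.mul_sum]
    exact Finset.sum_le_sum fun i _ => Nat.mul_le_mul_right _ (Nat.lt_succ_iff.mp i.isLt)
  zify at h
  rw [← ha.1, ← ha.2] at hw
  push_cast at hw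
  omega

/-- `D2 ∘ D1` has no negative eigenvalue on vectors of nonnegative `sl₂`-weight. -/
theorem eq_zero_of_D2_D1_eigen {d : ℕ} {n : ℤ} (k : ℕ) :
    ∀ {w c : ℤ} {v : MvPolynomial (Fin (d + 1)) ℂ},
      IsWeightedHomogeneous (biweight d) v (n, w) → w < k → 2 * w ≤ d * n → c < 0 →
      D2 d (D1 d v) = (c : ℂ) • v → v = 0 := by
  induction k with
  | zero => exact fun hv hk _ _ _ => eq_zero_of_neg hv (by simpa using hk)
  | succ k ih =>
    intro w c v hv hk hw hc h
    have hv' : IsWeightedHomogeneous (biweight d) (D1 d v) (n, w - 1) := by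
      simpa [sub_eq_add_neg] using hv.derivation (isWeightedHomogeneous_D1_X d)
    have h0 : D1 d v = 0 := by
      refine ih (c := c - (d * n - 2 * (w - 1))) hv' (by push_cast at hk; omega) (by omega)
        (by omega) ?_
      have := D1_D2_apply hv'
      rw [h, Derivation.map_smul] at this
      rw [Int.cast_sub, sub_smul, this, add_sub_cancel_right]
    rw [h0, map_zero, eq_comm, smul_eq_zero, Int.cast_eq_zero] at h
    exact h.resolve_left hc.ne

/-- `D1 ∘ D2` has no negative eigenvalue on vectors of nonpositive `sl₂`-weight. -/
theorem eq_zero_of_D1_D2_eigen {d : ℕ} {n : ℤ} (k : ℕ) :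
    ∀ {w c : ℤ} {v : MvPolynomial (Fin (d + 1)) ℂ},
      IsWeightedHomogeneous (biweight d) v (n, w) → d * n - w < k → d * n ≤ 2 * w → c < 0 →
      D1 d (D2 d v) = (c : ℂ) • v → v = 0 := by
  induction k with
  | zero => exact fun hv hk _ _ _ => eq_zero_of_gt hv (by push_cast at hk; omega)
  | succ k ih =>
    intro w c v hv hk hw hc h
    have hv' : IsWeightedHomogeneous (biweight d) (D2 d v) (n, w + 1) := by
      simpa using hv.derivation (isWeightedHomogeneous_D2_X d)
    have h0 : D2 d v = 0 := by
      refine ih (c := c + (d * n - 2 * (w + 1))) hv' (by push_cast at hk; omega) (by omega)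
        (by omega) ?_
      rw [D1_D2_apply hv', h, Derivation.map_smul, Int.cast_add, add_smul]
    rw [h0, map_zero, eq_comm, smul_eq_zero, Int.cast_eq_zero] at h
    exact h.resolve_left hc.ne

theorem eq_zero_of_D1_eq_zero {d : ℕ} {n w : ℤ} {v : MvPolynomial (Fin (d + 1)) ℂ}
    (hv : IsWeightedHomogeneous (biweight d) v (n, w)) (hw : d * n < 2 * w)
    (h : D1 d v = 0) : v = 0 := by
  refine eq_zero_of_D1_D2_eigen ((d * n - w).toNat + 1) hv (by omega) hw.le
    (c := d * n - 2 * w) (by omega) ?_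
  rw [D1_D2_apply hv, h, map_zero, zero_add]

theorem eq_zero_of_D1_D2_eq_zero {d : ℕ} {n w : ℤ} {v : MvPolynomial (Fin (d + 1)) ℂ}
    (hv : IsWeightedHomogeneous (biweight d) v (n, w)) (hw : 2 * w < d * n)
    (h : D1 d (D2 d v) = 0) : v = 0 := by
  refine eq_zero_of_D2_D1_eigen (w.toNat + 1) hv (by omega) hw.le
    (c := -(d * n - 2 * w)) (by omega) ?_
  have := D1_D2_apply hv
  rw [h, eq_comm, add_eq_zero_iff_eq_neg] at this
  rw [this, Int.cast_neg, neg_smul]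

theorem finite_setOf_degree_and (d n : ℕ) (P : (Fin (d + 1) →₀ ℕ) → Prop) :
    {a : Fin (d + 1) →₀ ℕ | a.degree = n ∧ P a}.Finite :=
  (Finsupp.finite_of_degree_le n).subset fun _ ha => ha.1.le

instance finiteDimensional_bihomogeneous (d : ℕ) (n : ℕ) (w : ℤ) :
    FiniteDimensional ℂ (weightedHomogeneousSubmodule ℂ (biweight d) ((n : ℤ), w)) := by
  have := (finite_setOf_degree_and d n fun _ => True).to_subtype
  have : FiniteDimensional ℂ
      (restrictSupport ℂ {a : Fin (d + 1) →₀ ℕ | a.degree = n ∧ True}) :=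
    Module.Finite.of_basis (basisRestrictSupport ℂ _)
  refine Submodule.finiteDimensional_of_le (S₂ := restrictSupport ℂ
    {a : Fin (d + 1) →₀ ℕ | a.degree = n ∧ True}) fun p hp => ?_
  refine (mem_restrictSupport_iff ℂ).mpr fun a ha => ?_
  have := hp (mem_support_iff.mp ha)
  rw [weight_biweight, Prod.mk.injEq] at this
  exact ⟨by rw [Finsupp.degree_eq_sum]; exact_mod_cast this.1, trivial⟩

theorem exists_D1_eq {d n : ℕ} {w : ℤ} (hw : 2 * w < d * n) {v : MvPolynomial (Fin (d + 1)) ℂ}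
    (hv : IsWeightedHomogeneous (biweight d) v ((n : ℤ), w)) :
    ∃ u, IsWeightedHomogeneous (biweight d) u ((n : ℤ), w + 1) ∧ D1 d u = v := by
  let V := weightedHomogeneousSubmodule ℂ (biweight d) ((n : ℤ), w)
  have h₂ {p} (hp : p ∈ V) :
      IsWeightedHomogeneous (biweight d) (D2 d p) ((n : ℤ), w + 1) := by
    simpa using IsWeightedHomogeneous.derivation (isWeightedHomogeneous_D2_X d) hp
  let T : V →ₗ[ℂ] V := ((D1 d).toLinearMap ∘ₗ (D2 d).toLinearMap).restrict fun p hp => by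
    simpa [V] using IsWeightedHomogeneous.derivation (isWeightedHomogeneous_D1_X d) (h₂ hp)
  have hT : Function.Injective T := by
    refine (injective_iff_map_eq_zero T).mpr fun p hp => Subtype.ext ?_
    exact eq_zero_of_D1_D2_eq_zero p.2 hw (congrArg Subtype.val hp)
  obtain ⟨p, hp⟩ := LinearMap.injective_iff_surjective.mp hT ⟨v, hv⟩
  exact ⟨D2 d p, h₂ p.2, congrArg Subtype.val hp⟩

/-- Exponents of degree `n` whose doubled index weight is at most `m`. -/
def lowExponents (d n : ℕ) (m : ℤ) : Set (Fin (d + 1) →₀ ℕ) :=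
  {a | a.degree = n ∧ ((2 * ∑ i, i.val * a i : ℕ) : ℤ) ≤ m}

instance finite_lowExponents (d n : ℕ) (m : ℤ) : Finite (lowExponents d n m) :=
  (finite_setOf_degree_and d n _).to_subtype

theorem finrank_restrictSupport_lowExponents (d n : ℕ) (m : ℤ) :
    Module.finrank ℂ (restrictSupport ℂ (lowExponents d n m)) = (lowExponents d n m).ncard := by
  rw [Module.finrank_eq_nat_card_basis (basisRestrictSupport ℂ _), Nat.card_coe_set_eq]

theorem map_D1_restrictSupport_lowExponents (d n : ℕ) :
    (restrictSupport ℂ (lowExponents d n (d * n))).map (D1 d).toLinearMap =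
      restrictSupport ℂ (lowExponents d n (d * n - 2)) := by
  have key {w m : ℤ} {p : MvPolynomial (Fin (d + 1)) ℂ}
      (hp : IsWeightedHomogeneous (biweight d) p ((n : ℤ), w)) (hw : 2 * w ≤ m) :
      p ∈ restrictSupport ℂ (lowExponents d n m) := by
    refine (mem_restrictSupport_iff ℂ).mpr fun a ha => ?_
    have := hp (mem_support_iff.mp ha)
    rw [weight_biweight, Prod.mk.injEq] at this
    refine ⟨by rw [Finsupp.degree_eq_sum]; exact_mod_cast this.1, ?_⟩
    push_cast at this ⊢
    omega
  have hmono {m : ℤ} {a : Fin (d + 1) →₀ ℕ} (ha : a ∈ lowExponents d n m) :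
      IsWeightedHomogeneous (biweight d) (monomial a (1 : ℂ))
        ((n : ℤ), ((∑ i, i.val * a i : ℕ) : ℤ)) := by
    refine isWeightedHomogeneous_monomial _ _ _ ?_
    rw [weight_biweight, ← Finsupp.degree_eq_sum, ha.1]
  apply le_antisymm
  · rw [Submodule.map_le_iff_le_comap, restrictSupport_eq_span, Submodule.span_le]
    rintro _ ⟨a, ha, rfl⟩
    refine key ((hmono ha).derivation (isWeightedHomogeneous_D1_X d)) ?_
    have := ha.2
    push_cast at this ⊢
    omega
  · rw [restrictSupport_eq_span ℂ (lowExponents d n (d * n - 2)), Submodule.span_le]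
    rintro _ ⟨a, ha, rfl⟩
    have h := ha.2
    obtain ⟨u, hu, hua⟩ := exists_D1_eq (by push_cast at h ⊢; omega) (hmono ha)
    exact ⟨u, key hu (by push_cast at h ⊢; omega), hua⟩

theorem Sn_eq (d n : ℕ) :
    Sn d n = restrictSupport ℂ (lowExponents d n (d * n)) ⊓ LinearMap.ker (D1 d).toLinearMap := by
  classical
  ext v
  refine and_congr_left fun hv => ?_
  replace hv : D1 d v = 0 := hv
  rw [SetLike.mem_coe, SetLike.mem_coe, homogeneousSubmodule_eq_finsupp_supported]
  refine ⟨fun h a ha => ⟨h ha, ?_⟩, fun h a ha => (h ha).1⟩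
  by_contra! hlt
  have hdeg : a.degree = n := h ha
  have hcomp := weightedHomogeneousComponent_isWeightedHomogeneous (w := biweight d)
    ((n : ℤ), ((∑ i, i.val * a i : ℕ) : ℤ)) v
  have h0 := eq_zero_of_D1_eq_zero hcomp (by push_cast at hlt ⊢; omega) (by
    rw [weightedHomogeneousComponent_derivation (isWeightedHomogeneous_D1_X d), hv, map_zero])
  have hcoeff := congrArg (coeff a) h0
  rw [coeff_weightedHomogeneousComponent, weight_biweight, ← Finsupp.degree_eq_sum, hdeg,
    if_pos rfl, coeff_zero] at hcoeff
  exact mem_support_iff.mp ha hcoeff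

theorem finrank_Sn_add (d n : ℕ) :
    Module.finrank ℂ (Sn d n) + (lowExponents d n (d * n - 2)).ncard =
      (lowExponents d n (d * n)).ncard := by
  have : FiniteDimensional ℂ (restrictSupport ℂ (lowExponents d n (d * n))) :=
    Module.Finite.of_basis (basisRestrictSupport ℂ _)
  have h := LinearMap.finrank_range_add_finrank_ker
    ((D1 d).toLinearMap.domRestrict (restrictSupport ℂ (lowExponents d n (d * n))))
  rw [LinearMap.range_domRestrict, map_D1_restrictSupport_lowExponents, LinearMap.ker_domRestrict,
    finrank_restrictSupport_lowExponents, finrank_restrictSupport_lowExponents,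
    ← Submodule.finrank_map_subtype_eq, Submodule.map_comap_subtype,
    ← Sn_eq] at h
  omega

theorem ncard_degree_and_weight_eq (d n : ℕ) (m : ℤ) :
    {α : Fin (d + 1) → ℕ | (∑ i, α i) = n ∧
        ((2 * ∑ i, i.val * α i : ℕ) : ℤ) = m}.ncard =
      {a : Fin (d + 1) →₀ ℕ | a.degree = n ∧ ((2 * ∑ i, i.val * a i : ℕ) : ℤ) = m}.ncard := by
  rw [← Set.ncard_image_of_injective _ Finsupp.equivFunOnFinite.injective,
    Equiv.image_eq_preimage_symm]
  congr 1
  ext α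
  simp [Finsupp.degree_eq_sum]

/-- Sylvester–Cayley-type formula (Theorem 1): dim S_n equals the number of
α ∈ ℕ^{d+1} with ∑α_i = n and 2(α_1+2α_2+⋯+dα_d) = dn, plus the number with
∑α_i = n and 2(α_1+2α_2+⋯+dα_d) = dn − 1. -/
theorem theorem1 (d : ℕ) (hd : 1 ≤ d) (n : ℕ) :
    Module.finrank ℂ (Sn d n) =
      {α : Fin (d + 1) → ℕ | (∑ i, α i) = n ∧
        ((2 * ∑ i, i.val * α i : ℕ) : ℤ) = (d : ℤ) * (n : ℤ)}.ncard +
      {α : Fin (d + 1) → ℕ | (∑ i, α i) = n ∧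
        ((2 * ∑ i, i.val * α i : ℕ) : ℤ) = (d : ℤ) * (n : ℤ) - 1}.ncard := by
  rw [ncard_degree_and_weight_eq, ncard_degree_and_weight_eq]
  have hstep (m : ℤ) : (lowExponents d n m).ncard = (lowExponents d n (m - 1)).ncard +
      {a : Fin (d + 1) →₀ ℕ |
        a.degree = n ∧ ((2 * ∑ i, i.val * a i : ℕ) : ℤ) = m}.ncard := by
    rw [← Set.ncard_union_eq _ (Set.toFinite _) (finite_setOf_degree_and d n _)]
    · congr 1
      ext a
      simp only [lowExponents, Set.mem_union, Set.mem_ofPred_eq, ← and_or_left]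
      exact and_congr_right fun _ => by omega
    · rw [Set.disjoint_left]
      rintro a ⟨-, h₁⟩ ⟨-, h₂⟩
      omega
  have h := finrank_Sn_add d n
  have h₁ := hstep (d * n)
  have h₂ := hstep (d * n - 1)
  rw [show (d * n - 1 - 1 : ℤ) = d * n - 2 by ring] at h₂
  omega

end
end

section
/- For d = 3, the Poincaré series of the algebra of covariants of the binary 3-form satisfies P_3(z) = (1 + z³)/((1 − z)(1 − z²)(1 − z⁴)), i.e. ∑_{n≥0} dim(S_n) z^n = (1 + z³) · ((1 − z)(1 − z²)(1 − z⁴))^{−1} in ℂ[[z]]. -/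
noncomputable section

/-- The Poincaré series P_d(z) = ∑_{n≥0} dim(S_n) zⁿ of the algebra of covariants. -/
def PSeries (d : ℕ) : PowerSeries ℂ :=
  PowerSeries.mk fun n => (Module.finrank ℂ (Sn d n) : ℂ)

open MvPolynomial in
/-- A polynomial killed by `D1 3` is constant along the flow of `D1 3`. -/
theorem aeval_flow_eq_of_D1_eq_zero {A : Type*} [CommRing A] [Algebra ℂ A]
    (p : Fin (3 + 1) → A) (t : A) {g : MvPolynomial (Fin (3 + 1)) ℂ} (hg : D1 3 g = 0) :
    aeval ![p 0, p 1 + t * p 0, p 2 + 2 * t * p 1 + t ^ 2 * p 0,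
      p 3 + 3 * t * p 2 + 3 * t ^ 2 * p 1 + t ^ 3 * p 0] g = aeval p g := by
  let x : Fin (3 + 1) → MvPolynomial (Fin (3 + 1)) ℂ := X
  let c : MvPolynomial (Fin (3 + 1)) ℂ → Polynomial (MvPolynomial (Fin (3 + 1)) ℂ) :=
    Polynomial.C
  let E : MvPolynomial (Fin (3 + 1)) ℂ →ₐ[ℂ] Polynomial (MvPolynomial (Fin (3 + 1)) ℂ) :=
    aeval ![c (x 0), c (x 1) + Polynomial.X * c (x 0),
      c (x 2) + 2 * Polynomial.X * c (x 1) + Polynomial.X ^ 2 * c (x 0),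
      c (x 3) + 3 * Polynomial.X * c (x 2) + 3 * Polynomial.X ^ 2 * c (x 1)
        + Polynomial.X ^ 3 * c (x 0)]
  have hE : ∀ f, Polynomial.derivative (E f) = E (D1 3 f) := by
    intro f
    induction f using MvPolynomial.induction_on with
    | C a =>
      rw [← MvPolynomial.algebraMap_eq, AlgHom.commutes, Derivation.map_algebraMap, map_zero,
        IsScalarTower.algebraMap_apply ℂ (MvPolynomial (Fin (3 + 1)) ℂ), Polynomial.algebraMap_apply]
      simp
    | add f g hf hg => simp [hf, hg]
    | mul_X f i hf =>
      have hX : Polynomial.derivative (E (X i)) = E (D1 3 (X i)) := by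
        have hC : ∀ n : ℕ, (C (n : ℂ) : MvPolynomial (Fin (3 + 1)) ℂ) = n := map_natCast C
        have hC2 : Polynomial.C (2 : MvPolynomial (Fin (3 + 1)) ℂ) = 2 := map_ofNat _ 2
        have hi : D1 3 (X i) = ((i : ℕ) : MvPolynomial (Fin (3 + 1)) ℂ) * X (i - 1) := by
          rw [← hC, ← smul_eq_C_mul]
          exact mkDerivation_X _ _ _
        rw [hi, map_mul, map_natCast]
        fin_cases i <;> simp [E, x, c] <;> grind
      rw [map_mul, Polynomial.derivative_mul, Derivation.leibniz, hf, hX]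
      simp only [smul_eq_mul, map_add, map_mul]
      ring
  have hconst : E g = Polynomial.C g := by
    have h0 : Polynomial.derivative (E g) = 0 := by rw [hE, hg, map_zero]
    have h1 := Polynomial.eq_C_of_derivative_eq_zero h0
    have h2 : Polynomial.coeff (E g) 0 = g := by
      rw [Polynomial.coeff_zero_eq_eval_zero]
      have : ((Polynomial.aeval (0 : MvPolynomial (Fin (3 + 1)) ℂ)).restrictScalars ℂ).comp E
          = AlgHom.id ℂ _ := by
        ext i : 1
        fin_cases i <;> simp [E, x, c]
      simpa [Polynomial.aeval_def, Polynomial.eval₂_id] using DFunLike.congr_fun this g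
    rw [h1, h2]
  let ev : Polynomial (MvPolynomial (Fin (3 + 1)) ℂ) →+* A :=
    Polynomial.eval₂RingHom (aeval p : MvPolynomial (Fin (3 + 1)) ℂ →ₐ[ℂ] A).toRingHom t
  have hev : ev (E g) = aeval ![p 0, p 1 + t * p 0, p 2 + 2 * t * p 1 + t ^ 2 * p 0,
      p 3 + 3 * t * p 2 + 3 * t ^ 2 * p 1 + t ^ 3 * p 0] g := by
    have : (ev.comp E.toRingHom) = (aeval ![p 0, p 1 + t * p 0, p 2 + 2 * t * p 1 + t ^ 2 * p 0,
      p 3 + 3 * t * p 2 + 3 * t ^ 2 * p 1 + t ^ 3 * p 0] :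
        MvPolynomial (Fin (3 + 1)) ℂ →ₐ[ℂ] A).toRingHom := by
      apply MvPolynomial.ringHom_ext
      · intro r
        simp [ev, ← MvPolynomial.algebraMap_eq,
          IsScalarTower.algebraMap_apply ℂ (MvPolynomial (Fin (3 + 1)) ℂ)
            (Polynomial (MvPolynomial (Fin (3 + 1)) ℂ))]
      · intro i
        fin_cases i <;> simp [ev, E, x, c] <;> ring
    exact DFunLike.congr_fun this g
  rw [← hev, hconst]
  simp [ev]

namespace BinaryCubic

open MvPolynomial

/-- The coordinate ring of binary cubics. -/
abbrev R : Type := MvPolynomial (Fin (3 + 1)) ℂ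

/-- One half, as a constant polynomial. -/
def half : R := C (1 / 2)

/-- The leading coefficient of the Hessian covariant. -/
def H : R := X 1 ^ 2 - X 0 * X 2

/-- The leading coefficient of the cubic covariant, normalised to be monic in `X 1`. -/
def T : R := X 1 ^ 3 - 3 * half * X 0 * X 1 * X 2 + half * X 0 ^ 2 * X 3

/-- A quarter of the discriminant. -/
def Δ : R :=
  half ^ 2 * (X 0 ^ 2 * X 3 ^ 2 - 6 * X 0 * X 1 * X 2 * X 3 + 4 * X 1 ^ 3 * X 3
    + 4 * X 0 * X 2 ^ 3 - 3 * X 1 ^ 2 * X 2 ^ 2)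

theorem two_mul_half : 2 * half = 1 := by
  have : (2 : R) = C 2 := (map_ofNat C 2).symm
  rw [this, half, ← C_mul]
  norm_num

theorem T_sq : T ^ 2 = H ^ 3 + X 0 ^ 2 * Δ := by
  have h := two_mul_half
  unfold T H Δ
  grind

theorem D1_half : D1 3 half = 0 := by
  rw [half, ← MvPolynomial.algebraMap_eq, Derivation.map_algebraMap]

theorem D1_X0 : D1 3 (X 0) = 0 := by simp [D1, mkDerivation_X]

theorem D1_X1 : D1 3 (X 1) = X 0 := by simp [D1, mkDerivation_X]

theorem D1_X2 : D1 3 (X 2) = 2 * X 1 := by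
  simp [D1, mkDerivation_X, smul_eq_C_mul]

theorem D1_X3 : D1 3 (X 3) = 3 * X 2 := by
  simp [D1, mkDerivation_X, smul_eq_C_mul]

theorem D1_natCast (n : ℕ) : D1 3 (n : R) = 0 := Derivation.map_natCast _ n

theorem D1_ofNat (n : ℕ) [n.AtLeastTwo] : D1 3 (ofNat(n) : R) = 0 := D1_natCast n

theorem D1_H : D1 3 H = 0 := by
  simp only [H, map_sub, Derivation.leibniz, Derivation.leibniz_pow, D1_X0, D1_X1, D1_X2,
    smul_eq_mul, nsmul_eq_mul]
  push_cast
  ring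

theorem D1_T : D1 3 T = 0 := by
  simp only [T, map_sub, map_add, Derivation.leibniz, Derivation.leibniz_pow, D1_X0, D1_X1, D1_X2,
    D1_X3, D1_half, D1_ofNat, smul_eq_mul, nsmul_eq_mul]
  push_cast
  linear_combination (-3 * X 0 * X 1 ^ 2 : R) * two_mul_half

theorem D1_Δ : D1 3 Δ = 0 := by
  simp only [Δ, map_sub, map_add, Derivation.leibniz, Derivation.leibniz_pow, D1_X0, D1_X1, D1_X2,
    D1_X3, D1_half, D1_ofNat, smul_eq_mul, nsmul_eq_mul]
  push_cast
  ring

theorem isHomogeneous_half : half.IsHomogeneous 0 := isHomogeneous_C _ _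

theorem isHomogeneous_ofNat (n : ℕ) [n.AtLeastTwo] : (ofNat(n) : R).IsHomogeneous 0 :=
  isHomogeneous_C _ (ofNat(n) : ℂ)

theorem isHomogeneous_H : H.IsHomogeneous 2 :=
  ((isHomogeneous_X ℂ _).pow 2).sub ((isHomogeneous_X ℂ _).mul (isHomogeneous_X ℂ _))

theorem isHomogeneous_T : T.IsHomogeneous 3 := by
  have x := fun i : Fin (3 + 1) => isHomogeneous_X ℂ i
  exact (((x 1).pow 3).sub (((((isHomogeneous_ofNat 3).mul isHomogeneous_half).mul (x 0)).mul
    (x 1)).mul (x 2))).add ((isHomogeneous_half.mul ((x 0).pow 2)).mul (x 3))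

theorem isHomogeneous_Δ : Δ.IsHomogeneous 4 := by
  have x := fun i : Fin (3 + 1) => isHomogeneous_X ℂ i
  have n := fun (k : ℕ) [k.AtLeastTwo] => isHomogeneous_ofNat k
  exact (isHomogeneous_half.pow 2).mul
    (((((((x 0).pow 2).mul ((x 3).pow 2)).sub
      (((((n 6).mul (x 0)).mul (x 1)).mul (x 2)).mul (x 3))).add
      (((n 4).mul ((x 1).pow 3)).mul (x 3))).add
      (((n 4).mul (x 0)).mul ((x 2).pow 3))).sub
      (((n 3).mul ((x 1).pow 2)).mul ((x 2).pow 2)))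

/-- The restriction of polynomials to the line `(0, 1, 0, t)`. -/
def restrict : R →ₐ[ℂ] Polynomial ℂ := aeval ![0, 1, 0, Polynomial.X]

theorem restrict_X0 : restrict (X 0) = 0 := by simp [restrict]

theorem restrict_H : restrict H = 1 := by simp [restrict, H]

theorem restrict_T : restrict T = 1 := by simp [restrict, T]

theorem restrict_Δ : restrict Δ = Polynomial.X := by
  have h : 2 * restrict half = 1 := by
    have := congrArg restrict two_mul_half
    rwa [map_mul, map_ofNat, map_one] at this
  have : restrict Δ = restrict half ^ 2 * (4 * Polynomial.X) := by simp [restrict, Δ]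
  rw [this]
  linear_combination (2 * restrict half + 1) * Polynomial.X * h

/-- The number of monomials of degree `n` in `H`, `T`, `Δ` that are at most linear in `T`. -/
def count (n : ℕ) : ℕ := (n + 4 - 3 * (n % 2)) / 4

/-- The monomial of degree `n` in `H`, `T`, `Δ` that is at most linear in `T` and has
degree `c` in `Δ`. -/
def gen (n c : ℕ) : R := T ^ (n % 2) * H ^ ((n - 4 * c - 3 * (n % 2)) / 2) * Δ ^ c

/-- The span of the monomials of degree `n` in `H`, `T`, `Δ` that are at most linear in `T`. -/
def U (n : ℕ) : Submodule ℂ R := Submodule.span ℂ (Set.range fun c : Fin (count n) => gen n c)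

/-- The degree `n` part of the algebra generated by `X 0`, `H`, `T`, `Δ`. -/
def W : ℕ → Submodule ℂ R
  | 0 => U 0
  | n + 1 => (W n).map (LinearMap.mulLeft ℂ (X 0)) ⊔ U (n + 1)

theorem restrict_gen (n c : ℕ) : restrict (gen n c) = Polynomial.X ^ c := by
  simp [gen, restrict_H, restrict_T, restrict_Δ]

theorem linearIndependent_gen (n : ℕ) :
    LinearIndependent ℂ fun c : Fin (count n) => gen n c := by
  apply LinearIndependent.of_comp restrict.toLinearMap
  have h := (Polynomial.basisMonomials ℂ).linearIndependent.comp
    (fun c : Fin (count n) => (c : ℕ)) Fin.val_injective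
  have hX : (restrict.toLinearMap ∘ fun c : Fin (count n) => gen n c)
      = (Polynomial.basisMonomials ℂ) ∘ fun c : Fin (count n) => (c : ℕ) := by
    funext c
    simp [restrict_gen, Polynomial.X_pow_eq_monomial]
  rw [hX]
  exact h

theorem finrank_U (n : ℕ) : Module.finrank ℂ (U n) = count n := by
  rw [U, finrank_span_eq_card (linearIndependent_gen n), Fintype.card_fin]

theorem eq_zero_of_restrict_eq_zero {n : ℕ} {u : R} (hu : u ∈ U n) (h : restrict u = 0) :
    u = 0 := by
  let σ : Polynomial ℂ →ₗ[ℂ] R := (Polynomial.basisMonomials ℂ).constr ℂ (gen n)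
  have hσ : Set.EqOn (σ.comp restrict.toLinearMap) (LinearMap.id : R →ₗ[ℂ] R) (U n) := by
    apply LinearMap.eqOn_span
    rintro _ ⟨c, rfl⟩
    have := (Polynomial.basisMonomials ℂ).constr_basis ℂ (gen n) c
    rw [Polynomial.coe_basisMonomials] at this
    beta_reduce at this
    rw [← Polynomial.X_pow_eq_monomial, ← restrict_gen n] at this
    exact this
  have := hσ hu
  rw [LinearMap.comp_apply, AlgHom.toLinearMap_apply, h, map_zero] at this
  exact this.symm

instance (n : ℕ) : FiniteDimensional ℂ (U n) :=
  FiniteDimensional.span_of_finite ℂ (Set.finite_range _)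

instance (n : ℕ) : FiniteDimensional ℂ (W n) := by
  induction n with
  | zero => exact inferInstanceAs (FiniteDimensional ℂ (U 0))
  | succ n ih =>
    exact inferInstanceAs (FiniteDimensional ℂ
      ((W n).map (LinearMap.mulLeft ℂ (X 0)) ⊔ U (n + 1) : Submodule ℂ R))

theorem U_le_W (n : ℕ) : U n ≤ W n := by
  cases n with
  | zero => exact le_rfl
  | succ n => exact le_sup_right

theorem X0_mul_mem_W {n : ℕ} {w : R} (hw : w ∈ W n) : X 0 * w ∈ W (n + 1) :=
  Submodule.mem_sup_left ⟨w, hw, rfl⟩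

theorem monomial_mem_U {n e b c : ℕ} (he : e < 2) (hn : 3 * e + 2 * b + 4 * c = n) :
    T ^ e * H ^ b * Δ ^ c ∈ U n := by
  have h1 : n % 2 = e := by omega
  have hc : c < count n := by unfold count; omega
  refine Submodule.subset_span ⟨⟨c, hc⟩, ?_⟩
  have h2 : (n - 4 * c - 3 * e) / 2 = b := by omega
  simp only [gen, h1, h2]

theorem gen_eq_monomial {n : ℕ} (c : Fin (count n)) :
    ∃ e b, e < 2 ∧ 3 * e + 2 * b + 4 * c = n ∧ gen n c = T ^ e * H ^ b * Δ ^ (c : ℕ) := by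
  have hc := c.2
  refine ⟨n % 2, (n - 4 * c - 3 * (n % 2)) / 2, by omega, ?_, rfl⟩
  unfold count at hc
  omega

/-- Multiplication by `y` shifts `W` by `k` as soon as it maps the generators of each `U n`
to `W (n + k)`. -/
theorem mul_mem_W_of_gen {y : R} {k : ℕ}
    (h : ∀ n (c : Fin (count n)), y * gen n c ∈ W (n + k)) {n : ℕ} {w : R} (hw : w ∈ W n) :
    y * w ∈ W (n + k) := by
  have hU : ∀ n, ∀ u ∈ U n, y * u ∈ W (n + k) := by
    intro n
    change U n ≤ (W (n + k)).comap (LinearMap.mulLeft ℂ y)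
    rw [U, Submodule.span_le]
    rintro _ ⟨c, rfl⟩
    exact h n c
  induction n generalizing w with
  | zero => exact hU 0 w hw
  | succ n ih =>
    obtain ⟨_, ⟨v, hv, rfl⟩, u, hu, rfl⟩ := Submodule.mem_sup.1 hw
    rw [mul_add]
    refine add_mem ?_ (hU _ u hu)
    have := X0_mul_mem_W (ih hv)
    rw [LinearMap.mulLeft_apply, mul_left_comm, Nat.add_right_comm]
    exact this

theorem H_mul_mem_W {n : ℕ} {w : R} (hw : w ∈ W n) : H * w ∈ W (n + 2) := by
  refine mul_mem_W_of_gen (fun n c => U_le_W _ ?_) hw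
  obtain ⟨e, b, he, hn, hg⟩ := gen_eq_monomial c
  have := monomial_mem_U (n := n + 2) (b := b + 1) (c := c) he (by omega)
  rw [hg]
  convert this using 1
  ring

theorem T_mul_mem_W {n : ℕ} {w : R} (hw : w ∈ W n) : T * w ∈ W (n + 3) := by
  refine mul_mem_W_of_gen (fun n c => ?_) hw
  obtain ⟨e, b, he, hn, hg⟩ := gen_eq_monomial c
  rw [hg]
  interval_cases e
  · have := monomial_mem_U (n := n + 3) (e := 1) (b := b) (c := c) (by omega) (by omega)
    convert U_le_W _ this using 1
    ring
  · have h1 := U_le_W _ (monomial_mem_U (n := n + 3) (e := 0) (b := b + 3) (c := c)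
      (by omega) (by omega))
    have h2 := U_le_W _ (monomial_mem_U (n := n + 1) (e := 0) (b := b) (c := c + 1)
      (by omega) (by omega))
    convert add_mem h1 (X0_mul_mem_W (X0_mul_mem_W h2)) using 1
    linear_combination H ^ b * Δ ^ (c : ℕ) * T_sq

theorem one_mem_W : (1 : R) ∈ W 0 := by
  simpa using U_le_W _ (monomial_mem_U (n := 0) (e := 0) (b := 0) (c := 0) (by omega) (by omega))

theorem mul_mem_Sn {m n : ℕ} {f g : R} (hf : f ∈ Sn 3 m) (hg : g ∈ Sn 3 n) :
    f * g ∈ Sn 3 (m + n) := by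
  refine ⟨hf.1.mul hg.1, ?_⟩
  have hf' : D1 3 f = 0 := hf.2
  have hg' : D1 3 g = 0 := hg.2
  change D1 3 (f * g) = 0
  simp [Derivation.leibniz, hf', hg']

theorem pow_mem_Sn {m : ℕ} {f : R} (hf : f ∈ Sn 3 m) (k : ℕ) : f ^ k ∈ Sn 3 (m * k) := by
  refine ⟨hf.1.pow k, ?_⟩
  have hf' : D1 3 f = 0 := hf.2
  change D1 3 (f ^ k) = 0
  simp [Derivation.leibniz_pow, hf']

theorem U_le_Sn (n : ℕ) : U n ≤ Sn 3 n := by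
  rw [U, Submodule.span_le]
  rintro _ ⟨c, rfl⟩
  obtain ⟨e, b, he, hn, hg⟩ := gen_eq_monomial c
  have := mul_mem_Sn (mul_mem_Sn (pow_mem_Sn ⟨isHomogeneous_T, D1_T⟩ e)
    (pow_mem_Sn ⟨isHomogeneous_H, D1_H⟩ b)) (pow_mem_Sn ⟨isHomogeneous_Δ, D1_Δ⟩ c)
  rw [hn, ← hg] at this
  exact this

theorem W_le_Sn (n : ℕ) : W n ≤ Sn 3 n := by
  induction n with
  | zero => exact U_le_Sn 0
  | succ n ih =>
    refine sup_le ?_ (U_le_Sn _)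
    rintro _ ⟨w, hw, rfl⟩
    rw [LinearMap.mulLeft_apply, mul_comm]
    exact mul_mem_Sn (ih hw) ⟨isHomogeneous_X ℂ 0, D1_X0⟩

theorem mem_W_of_X0_mul_mem {n : ℕ} {g : R} (h : X 0 * g ∈ W (n + 1)) : g ∈ W n := by
  obtain ⟨_, ⟨w, hw, rfl⟩, u, hu, hg⟩ := Submodule.mem_sup.1 h
  rw [LinearMap.mulLeft_apply] at hg
  have hu0 : u = 0 := eq_zero_of_restrict_eq_zero hu <| by
    simpa [restrict_X0] using congrArg restrict hg
  rw [hu0, add_zero] at hg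
  rwa [← mul_left_cancel₀ (X_ne_zero (0 : Fin (3 + 1))) hg]

theorem mem_W_of_X0_pow_mul_mem {n k : ℕ} {g : R} (h : X 0 ^ k * g ∈ W (n + k)) : g ∈ W n := by
  induction k with
  | zero => simpa using h
  | succ k ih =>
    apply ih
    apply mem_W_of_X0_mul_mem
    rw [← mul_assoc, ← pow_succ']
    exact h

theorem pow_mul_mem_W {y : R} {k : ℕ} (h : ∀ n, ∀ w ∈ W n, y * w ∈ W (n + k)) (s : ℕ) {n : ℕ}
    {w : R} (hw : w ∈ W n) : y ^ s * w ∈ W (n + k * s) := by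
  induction s with
  | zero => simpa using hw
  | succ s ih =>
    rw [pow_succ', mul_assoc, Nat.mul_succ, ← add_assoc]
    exact h _ _ ih

/-- Substituting elements shifting `W` by `k` in a form of degree `n` gives an element of
`W (k * n)`. -/
theorem aeval_mem_W {y : Fin (3 + 1) → R} {k : ℕ}
    (h : ∀ i n, ∀ w ∈ W n, y i * w ∈ W (n + k)) {n : ℕ} {g : R} (hg : g.IsHomogeneous n) :
    aeval y g ∈ W (k * n) := by
  rw [aeval_def, eval₂_eq']
  refine Submodule.sum_mem _ fun d hd => ?_
  rw [← Algebra.smul_def]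
  refine Submodule.smul_mem _ _ ?_
  have hdn : d 0 + d 1 + d 2 + d 3 = n := by
    rw [← hg (mem_support_iff.1 hd), Finsupp.weight_apply, Finsupp.sum_fintype _ _ (by simp)]
    simp [Fin.sum_univ_four]
  have := pow_mul_mem_W (h 0) (d 0) (pow_mul_mem_W (h 1) (d 1) (pow_mul_mem_W (h 2) (d 2)
    (pow_mul_mem_W (h 3) (d 3) one_mem_W)))
  rw [← hdn]
  convert this using 2
  · ring
  · simp [Fin.prod_univ_four, mul_assoc]

theorem aeval_mul_of_isHomogeneous {A : Type*} [CommRing A] [Algebra ℂ A] {n : ℕ} {g : R}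
    (hg : g.IsHomogeneous n) (k : A) (y : Fin (3 + 1) → A) :
    aeval (fun i => k * y i) g = k ^ n * aeval y g := by
  simp only [aeval_def, eval₂_eq', Finset.mul_sum]
  refine Finset.sum_congr rfl fun d hd => ?_
  have hdn : ∑ i, d i = n := by
    rw [← hg (mem_support_iff.1 hd), Finsupp.weight_apply, Finsupp.sum_fintype _ _ (by simp)]
    simp
  simp only [mul_pow, Finset.prod_mul_distrib, Finset.prod_pow_eq_pow_sum, hdn]
  ring

theorem pow_mul_aeval_eq {K : Type*} [Field K] [Algebra ℂ K] {p : Fin (3 + 1) → K} (hp : p 0 ≠ 0)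
    {n : ℕ} {g : R} (hg : g ∈ Sn 3 n) :
    p 0 ^ (2 * n) * aeval p g = aeval ![p 0 ^ 3, 0, -(p 0 * (p 1 ^ 2 - p 0 * p 2)),
      2 * p 1 ^ 3 - 3 * p 0 * p 1 * p 2 + p 0 ^ 2 * p 3] g := by
  rw [← aeval_flow_eq_of_D1_eq_zero p (-(p 1 / p 0)) hg.2, pow_mul,
    ← aeval_mul_of_isHomogeneous hg.1]
  congr 2
  funext i
  fin_cases i <;> simp <;> field_simp <;> first | ring1 | simp

theorem X0_pow_mul_eq_aeval {n : ℕ} {g : R} (hg : g ∈ Sn 3 n) :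
    X 0 ^ (2 * n) * g = aeval ![X 0 ^ 3, 0, -(X 0 * H), 2 * T] g := by
  let K := FractionRing R
  apply IsFractionRing.injective R K
  let p : Fin (3 + 1) → K := fun i => algebraMap R K (X i)
  have hp : p 0 ≠ 0 := by
    simp [p]
  have hpg : aeval p g = algebraMap R K g := by
    rw [show p = algebraMap R K ∘ X from rfl, MvPolynomial.aeval_algebraMap_apply,
      aeval_X_left_apply]
  have hT : 2 * T = 2 * X 1 ^ 3 - 3 * X 0 * X 1 * X 2 + X 0 ^ 2 * X 3 := by
    rw [T]
    linear_combination (X 0 ^ 2 * X 3 - 3 * X 0 * X 1 * X 2) * two_mul_half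
  rw [map_mul, map_pow, ← hpg]
  refine (pow_mul_aeval_eq hp hg).trans ?_
  rw [← MvPolynomial.aeval_algebraMap_apply]
  congr 2
  funext i
  fin_cases i
  · exact (map_pow _ _ _).symm
  · exact (map_zero _).symm
  · change _ = algebraMap R K (-(X 0 * H))
    simp only [H, map_neg, map_mul, map_sub, map_pow]
    rfl
  · change _ = algebraMap R K (2 * T)
    simp only [hT, map_add, map_mul, map_sub, map_pow, map_ofNat]
    rfl

theorem Sn_eq_W (n : ℕ) : Sn 3 n = W n := by
  refine le_antisymm (fun g hg => ?_) (W_le_Sn n)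
  apply mem_W_of_X0_pow_mul_mem (k := 2 * n)
  rw [X0_pow_mul_eq_aeval hg, show n + 2 * n = 3 * n by ring]
  refine aeval_mem_W (fun i m w hw => ?_) hg.1
  fin_cases i
  · convert X0_mul_mem_W (X0_mul_mem_W (X0_mul_mem_W hw)) using 1
    change X 0 ^ 3 * w = _
    ring
  · simp
  · convert neg_mem (X0_mul_mem_W (H_mul_mem_W hw)) using 1
    change -(X 0 * H) * w = _
    ring
  · convert Submodule.smul_mem _ (2 : ℂ) (T_mul_mem_W hw) using 1
    change 2 * T * w = _
    rw [smul_eq_C_mul, mul_assoc, map_ofNat]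

theorem finrank_W_succ (n : ℕ) :
    Module.finrank ℂ (W (n + 1)) = Module.finrank ℂ (W n) + count (n + 1) := by
  have hinj : Function.Injective (LinearMap.mulLeft ℂ (X 0 : R)) :=
    fun _ _ h => mul_left_cancel₀ (X_ne_zero _) h
  have hdisj : (W n).map (LinearMap.mulLeft ℂ (X 0)) ⊓ U (n + 1) = ⊥ := by
    rw [eq_bot_iff]
    rintro _ ⟨⟨w, -, rfl⟩, hu⟩
    exact eq_zero_of_restrict_eq_zero hu (by simp [restrict_X0])
  have h := Submodule.finrank_sup_add_finrank_inf_eq ((W n).map (LinearMap.mulLeft ℂ (X 0)))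
    (U (n + 1))
  rwa [hdisj, finrank_bot, add_zero, finrank_U,
    ← (Submodule.equivMapOfInjective _ hinj (W n)).finrank_eq] at h

theorem count_add_four (n : ℕ) : count (n + 4) = count n + 1 := by
  unfold count
  omega

theorem finrank_Sn (n : ℕ) : Module.finrank ℂ (Sn 3 n) = Module.finrank ℂ (W n) := by
  rw [Sn_eq_W]

theorem PSeries_mul_one_sub_X :
    PSeries 3 * (1 - PowerSeries.X) = PowerSeries.mk fun n => (count n : ℂ) := by
  ext n
  rw [mul_sub, mul_one, map_sub]
  cases n with
  | zero =>
    have : Module.finrank ℂ (W 0) = count 0 := finrank_U 0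
    simp [PSeries, finrank_Sn, this]
  | succ n => simp [PSeries, PowerSeries.coeff_succ_mul_X, finrank_Sn, finrank_W_succ]

theorem mk_count_mul :
    (PowerSeries.mk fun n => (count n : ℂ)) * (1 - PowerSeries.X ^ 4)
      = PowerSeries.mk fun n => if n = 1 then 0 else 1 := by
  ext n
  rw [mul_sub, mul_one, map_sub, PowerSeries.coeff_mul_X_pow']
  split_ifs with h
  · obtain ⟨m, rfl⟩ := Nat.exists_eq_add_of_le' h
    simp [count_add_four]
  · interval_cases n <;> simp [count]

theorem mk_ite_mul :
    (PowerSeries.mk fun n => if n = 1 then (0 : ℂ) else 1) * (1 - PowerSeries.X ^ 2)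
      = 1 + PowerSeries.X ^ 3 := by
  ext n
  rw [mul_sub, mul_one, map_sub, PowerSeries.coeff_mul_X_pow', map_add, PowerSeries.coeff_one,
    PowerSeries.coeff_X_pow, PowerSeries.coeff_mk, PowerSeries.coeff_mk]
  rcases lt_or_ge n 4 with h | h
  · interval_cases n <;> simp
  · simp [show n ≠ 0 by omega, show n ≠ 1 by omega, show n ≠ 3 by omega, show 2 ≤ n by omega,
      show n - 2 ≠ 1 by omega]

end BinaryCubic

/-- The Poincaré series of the algebra of covariants of the binary 3-form. -/
theorem poincare_series_d3 :
    PSeries 3 = (1 + (PowerSeries.X : PowerSeries ℂ) ^ 3) * ((1 - (PowerSeries.X : PowerSeries ℂ)) * (1 - (PowerSeries.X : PowerSeries ℂ) ^ 2) * (1 - (PowerSeries.X : PowerSeries ℂ) ^ 4))⁻¹ := by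
  rw [PowerSeries.eq_mul_inv_iff_mul_eq (by simp), ← BinaryCubic.mk_ite_mul,
    ← BinaryCubic.mk_count_mul, ← BinaryCubic.PSeries_mul_one_sub_X]
  ring

end
end
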